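/- If S ⊆ I is such that every fully dotted column x of S satisfies x^S ≠ x, then F·b_S = 0. -/

import Mathlib

noncomputable section

/-- The field `𝔽 = ℚ(q)`. -/
abbrev Fq : Type := RatFunc ℚ

/-- The quantum parameter `q`. -/
def qv : Fq := RatFunc.X

/-- The index set `I = {1,…,n} ∪ {−n,…,−1}` as a finset of integers. -/
def Iset (n : ℕ) : Finset ℤ := (Finset.Icc (-(n : ℤ)) (n : ℤ)).erase 0

/-- Subsets of `I`, the index type for the standard basis. -/
abbrev Bset (n : ℕ) : Type := {S : Finset ℤ // S ⊆ Iset n}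

/-- `Λ`, the free `𝔽`-vector space with basis `{v_S : S ⊆ I}`. -/
abbrev Lam (n : ℕ) : Type := Bset n →₀ Fq

/-- The standard basis vector `v_S`. -/
def bv (n : ℕ) (S : Bset n) : Lam n := Finsupp.single S 1

/-- The standard basis vector `v_T` for a finset `T ⊆ I` (and `0` for junk input). -/
def vS (n : ℕ) (T : Finset ℤ) : Lam n :=
  if h : T ⊆ Iset n then Finsupp.single (⟨T, h⟩ : Bset n) (1 : Fq) else 0

/-- The linear operator on `Λ` determined by prescribed values on the standard basis. -/
def mkOp (n : ℕ) (g : Bset n → Lam n) : Module.End Fq (Lam n) :=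
  Finsupp.linearCombination Fq g

/-- The four positions `{i, i+1, −i, −(i+1)}`. -/
def quad (i : ℤ) : Finset ℤ := {i, i + 1, -i, -(i + 1)}

/-- Value of `f_i` on `v_S`. -/
def fAct (n : ℕ) (i : ℤ) (S : Finset ℤ) : Lam n :=
  if i = (n : ℤ) then
    (if (n : ℤ) ∈ S ∧ -(n : ℤ) ∉ S then vS n (insert (-(n : ℤ)) (S.erase (n : ℤ))) else 0)
  else
    (if S ∩ quad i = {i} then vS n (insert (i + 1) (S.erase i))
     else if S ∩ quad i = {-(i + 1)} then vS n (insert (-i) (S.erase (-(i + 1))))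
     else if S ∩ quad i = ({i, -(i + 1)} : Finset ℤ) then
       vS n (insert (-i) (S.erase (-(i + 1)))) + qv⁻¹ • vS n (insert (i + 1) (S.erase i))
     else if S ∩ quad i = ({i, -i} : Finset ℤ) then qv • vS n (insert (i + 1) (S.erase i))
     else if S ∩ quad i = ({i + 1, -(i + 1)} : Finset ℤ) then
       vS n (insert (-i) (S.erase (-(i + 1))))
     else if S ∩ quad i = ({i, -(i + 1), -i} : Finset ℤ) then vS n (insert (i + 1) (S.erase i))
     else if S ∩ quad i = ({i, i + 1, -(i + 1)} : Finset ℤ) then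
       vS n (insert (-i) (S.erase (-(i + 1))))
     else 0)

/-- Value of `e_i` on `v_S`. -/
def eAct (n : ℕ) (i : ℤ) (S : Finset ℤ) : Lam n :=
  if i = (n : ℤ) then
    (if -(n : ℤ) ∈ S ∧ (n : ℤ) ∉ S then vS n (insert (n : ℤ) (S.erase (-(n : ℤ)))) else 0)
  else
    (if S ∩ quad i = {-i} then vS n (insert (-(i + 1)) (S.erase (-i)))
     else if S ∩ quad i = {i + 1} then vS n (insert i (S.erase (i + 1)))
     else if S ∩ quad i = ({i + 1, -i} : Finset ℤ) then
       vS n (insert i (S.erase (i + 1))) + qv⁻¹ • vS n (insert (-(i + 1)) (S.erase (-i)))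
     else if S ∩ quad i = ({i, -i} : Finset ℤ) then qv • vS n (insert (-(i + 1)) (S.erase (-i)))
     else if S ∩ quad i = ({i + 1, -(i + 1)} : Finset ℤ) then vS n (insert i (S.erase (i + 1)))
     else if S ∩ quad i = ({i, i + 1, -i} : Finset ℤ) then
       vS n (insert (-(i + 1)) (S.erase (-i)))
     else if S ∩ quad i = ({i + 1, -(i + 1), -i} : Finset ℤ) then vS n (insert i (S.erase (i + 1)))
     else 0)

/-- Coefficient of `ε_j` in `wt(S)`. -/
def epsCoef (S : Finset ℤ) (j : ℤ) : ℤ :=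
  (if j ∈ S then 1 else 0) - (if -j ∈ S then 1 else 0)

/-- The pairing `(α_i, wt S)`. -/
def alphaPair (n : ℕ) (i : ℤ) (S : Finset ℤ) : ℤ :=
  if i = (n : ℤ) then 2 * epsCoef S (n : ℤ) else epsCoef S i - epsCoef S (i + 1)

/-- The operator `f_i` on `Λ`. -/
def fop (n : ℕ) (i : ℤ) : Module.End Fq (Lam n) := mkOp n (fun S => fAct n i S.1)

/-- The operator `e_i` on `Λ`. -/
def eop (n : ℕ) (i : ℤ) : Module.End Fq (Lam n) := mkOp n (fun S => eAct n i S.1)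

/-- The operator `k_i` on `Λ`, `k_i · v_S = q^{(α_i, wt S)} v_S`. -/
def kop (n : ℕ) (i : ℤ) : Module.End Fq (Lam n) :=
  mkOp n (fun S => (qv ^ alphaPair n i S.1) • bv n S)

/-- The operator `k_i⁻¹` on `Λ`. -/
def kinvop (n : ℕ) (i : ℤ) : Module.End Fq (Lam n) :=
  mkOp n (fun S => (qv ^ (-alphaPair n i S.1)) • bv n S)

/-- `−S`. -/
def negSet (S : Finset ℤ) : Finset ℤ := S.image (fun x => -x)

/-- `S₀ = S ∩ (−S)`, the fully dotted columns. -/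
def Szero (S : Finset ℤ) : Finset ℤ := S ∩ negSet S

/-- `S₀^c = (I∖S) ∩ (−(I∖S))`, the undotted columns. -/
def Szeroc (n : ℕ) (S : Finset ℤ) : Finset ℤ := (Iset n \ S) ∩ negSet (Iset n \ S)

/-- `w(S) = (|S₀| − |S₀^c|)/2`. -/
def wTot (n : ℕ) (S : Finset ℤ) : ℤ :=
  (((Szero S).card : ℤ) - ((Szeroc n S).card : ℤ)) / 2

/-- `w_{>i}(S)`. -/
def wGt (n : ℕ) (i : ℤ) (S : Finset ℤ) : ℤ :=
  ((((Szero S).filter (fun x => i < |x| ∧ |x| ≤ (n : ℤ))).card : ℤ)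
    - (((Szeroc n S).filter (fun x => i < |x| ∧ |x| ≤ (n : ℤ))).card : ℤ)) / 2

/-- `w_{<i}(S)`. -/
def wLt (n : ℕ) (i : ℤ) (S : Finset ℤ) : ℤ :=
  ((((Szeroc n S).filter (fun x => x ≠ 0 ∧ |x| < i)).card : ℤ)
    - (((Szero S).filter (fun x => x ≠ 0 ∧ |x| < i)).card : ℤ)) / 2

/-- Value of `E` on `v_S`. -/
def EAct (n : ℕ) (S : Finset ℤ) : Lam n :=
  ∑ i ∈ (Finset.Icc (1 : ℤ) (n : ℤ)).filter (fun i => i ∈ Szeroc n S ∧ -i ∈ Szeroc n S),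
    ((-qv) ^ wGt n i S) • vS n (insert i (insert (-i) S))

/-- Value of `F` on `v_S`. -/
def FAct (n : ℕ) (S : Finset ℤ) : Lam n :=
  ∑ i ∈ (Finset.Icc (1 : ℤ) (n : ℤ)).filter (fun i => i ∈ Szero S ∧ -i ∈ Szero S),
    ((-qv) ^ wLt n i S) • vS n ((S.erase i).erase (-i))

/-- The operator `E` on `Λ`. -/
def Eop (n : ℕ) : Module.End Fq (Lam n) := mkOp n (fun S => EAct n S.1)

/-- The operator `F` on `Λ`. -/
def Fop (n : ℕ) : Module.End Fq (Lam n) := mkOp n (fun S => FAct n S.1)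

/-- The operator `K` on `Λ`, `K · v_S = (−q)^{w(S)} v_S`. -/
def Kop (n : ℕ) : Module.End Fq (Lam n) := mkOp n (fun S => ((-qv) ^ wTot n S.1) • bv n S)

/-- The operator `K⁻¹` on `Λ`. -/
def Kinvop (n : ℕ) : Module.End Fq (Lam n) :=
  mkOp n (fun S => ((-qv) ^ (-wTot n S.1)) • bv n S)

/-- Balanced quantum integer `[m]_x`. -/
def qNum (x : Fq) (m : ℕ) : Fq := (x ^ (m : ℤ) - x ^ (-(m : ℤ))) / (x - x⁻¹)

/-- Quantum factorial `[m]_x!`. -/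
def qFact (x : Fq) (m : ℕ) : Fq := ∏ j ∈ Finset.range m, qNum x (j + 1)

/-- Gaussian binomial coefficient in the variable `x`. -/
def qBinom (x : Fq) (m s : ℕ) : Fq := qFact x m / (qFact x s * qFact x (m - s))

/-- The variable `q_i`: `q` for `i < n` and `q²` for `i = n`. -/
def qsub (n : ℕ) (i : ℤ) : Fq := if i = (n : ℤ) then qv ^ 2 else qv

/-- The subring `A = ℤ[q,q⁻¹] ⊆ 𝔽`. -/
def Asub : Subring Fq := Subring.closure {qv, qv⁻¹}

/-- The `A`-lattice `Λ_A ⊆ Λ`: the `A`-span of all `v_S`. -/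
def LamA (n : ℕ) : Set (Lam n) :=
  {x | ∃ c : Bset n →₀ Fq, (∀ S, c S ∈ Asub) ∧ x = c.sum (fun S a => a • bv n S)}

/-- The degree-`k` part `Λ^k ⊆ Λ`. -/
def Lk (n k : ℕ) : Submodule Fq (Lam n) :=
  Submodule.span Fq {x | ∃ S : Bset n, S.1.card = k ∧ x = bv n S}

/-- The divided power `E^{(m)} = E^m/[m]!`. -/
def Ediv (n : ℕ) (m : ℕ) : Module.End Fq (Lam n) := (qFact qv m)⁻¹ • (Eop n ^ m)

/-- The divided power `F^{(m)} = F^m/[m]!`. -/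
def Fdiv (n : ℕ) (m : ℕ) : Module.End Fq (Lam n) := (qFact qv m)⁻¹ • (Fop n ^ m)

/-- One step of the matching algorithm at column `x`, acting on the pair
(partial assignment, set `U` of unmatched undotted columns). -/
def stepCol (S : Finset ℤ) (x : ℤ) (p : (ℤ → ℤ) × Finset ℤ) : (ℤ → ℤ) × Finset ℤ :=
  if x ∈ S ∧ -x ∈ S then
    (if hU : p.2.Nonempty then
      (Function.update p.1 x (p.2.min' hU), p.2.erase (p.2.min' hU))
     else (Function.update p.1 x x, p.2))
  else if x ∉ S ∧ -x ∉ S then (p.1, insert x p.2)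
  else p

/-- Running the matching algorithm over the columns `n, n−1, …, 1`. -/
def matchData (n : ℕ) (S : Finset ℤ) : (ℤ → ℤ) × Finset ℤ :=
  ((List.range n).map (fun t => (n : ℤ) - t)).foldl (fun p x => stepCol S x p) (id, ∅)

/-- The matching `x ↦ x^S`. -/
def matchCol (n : ℕ) (S : Finset ℤ) (x : ℤ) : ℤ := (matchData n S).1 x

/-- `L(S)`: fully dotted columns matched to an undotted column. -/
def LSet (n : ℕ) (S : Finset ℤ) : Finset ℤ :=
  (Finset.Icc (1 : ℤ) (n : ℤ)).filter (fun x => x ∈ S ∧ -x ∈ S ∧ matchCol n S x ≠ x)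

/-- `±X`. -/
def pmSet (X : Finset ℤ) : Finset ℤ := X ∪ negSet X

/-- The canonical basis vector `b_S`. -/
def bvecL (n : ℕ) (S : Finset ℤ) : Lam n :=
  ∑ X ∈ (LSet n S).powerset,
    (qv ^ (-(X.card : ℤ))) • vS n ((S \ pmSet X) ∪ pmSet (X.image (matchCol n S)))

/-- Column `z` is fully dotted for `S`. -/
def IsDotted (S : Finset ℤ) (z : ℤ) : Prop := z ∈ S ∧ -z ∈ S

/-- Column `z` is undotted for `S`. -/
def IsUndotted (S : Finset ℤ) (z : ℤ) : Prop := z ∉ S ∧ -z ∉ S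

lemma IsDotted.not_isUndotted {S : Finset ℤ} {z : ℤ} (h : IsDotted S z) : ¬ IsUndotted S z :=
  fun h' => h'.1 h.1

/-- Column `x ∈ (m, n]` is fully dotted and moved by the partial assignment `f`. -/
def IsMatched (S : Finset ℤ) (n m : ℤ) (f : ℤ → ℤ) (x : ℤ) : Prop :=
  m < x ∧ x ≤ n ∧ IsDotted S x ∧ f x ≠ x

/-- The properties of the matching algorithm after the columns in `(m, n]` were processed. -/
structure MatchInvariant (S : Finset ℤ) (n m : ℤ) (f : ℤ → ℤ) (U : Finset ℤ) : Prop where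
  free : ∀ u ∈ U, m < u ∧ u ≤ n ∧ IsUndotted S u
  target : ∀ x, IsMatched S n m f x → x < f x ∧ f x ≤ n ∧ IsUndotted S (f x) ∧ f x ∉ U
  inj : ∀ x y, IsMatched S n m f x → IsMatched S n m f y → f x = f y → x = y
  cover : ∀ z, m < z → z ≤ n → IsUndotted S z → z ∈ U ∨ ∃ y, IsMatched S n m f y ∧ f y = z
  inner_dotted : ∀ x, IsMatched S n m f x → ∀ y, x < y → y < f x → IsDotted S y →
    f y ≠ y ∧ f y < f x
  inner_undotted : ∀ x, IsMatched S n m f x → ∀ z, x < z → z < f x → IsUndotted S z →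
    ∃ y, x < y ∧ IsMatched S n m f y ∧ f y = z
  unmatched : ∀ y, m < y → y ≤ n → IsDotted S y → f y = y → ∀ u ∈ U, u < y

lemma MatchInvariant.step {S : Finset ℤ} {n m : ℤ} {p : (ℤ → ℤ) × Finset ℤ}
    (hp : MatchInvariant S n m p.1 p.2) (hm : m ≤ n) :
    MatchInvariant S n (m - 1) (stepCol S m p).1 (stepCol S m p).2 := by
  obtain ⟨f, U⟩ := p
  obtain ⟨h1, h2, h3, h4, h5, h6, h7⟩ := hp
  simp only at h1 h2 h3 h4 h5 h6 h7
  unfold stepCol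
  split_ifs with hD hU hN
  · have hu := U.min'_mem hU
    have hmin : ∀ v ∈ U, U.min' hU ≤ v := fun v hv => U.min'_le v hv
    simp only
    generalize U.min' hU = u at hu hmin ⊢
    have hDm : IsDotted S m := hD
    have hfm : Function.update f m u m = u := by simp
    have hf : ∀ x, x ≠ m → Function.update f m u x = f x := fun x hx => by simp [hx]
    have huu := h1 u hu
    have hM : ∀ x, IsMatched S n (m - 1) (Function.update f m u) x →
        x = m ∨ (m < x ∧ IsMatched S n m f x) := by
      rintro x ⟨a, b, c, d⟩
      by_cases hx : x = m
      · exact Or.inl hx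
      · rw [hf x hx] at d
        exact Or.inr ⟨by lia, by lia, b, c, d⟩
    have hM' : ∀ x, IsMatched S n m f x →
        IsMatched S n (m - 1) (Function.update f m u) x ∧ x ≠ m := by
      rintro x ⟨a, b, c, d⟩
      have : x ≠ m := by lia
      exact ⟨⟨by lia, b, c, by rwa [hf x this]⟩, this⟩
    have key : ∀ x, IsMatched S n m f x → f x ≠ u := fun x hx h => (h2 x hx).2.2.2 (h ▸ hu)
    refine ⟨?_, ?_, ?_, ?_, ?_, ?_, ?_⟩
    · intro v hv
      obtain ⟨a, b, c⟩ := h1 v (Finset.mem_of_mem_erase hv)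
      exact ⟨by lia, b, c⟩
    · intro x hx
      rcases hM x hx with rfl | ⟨hx1, hx2⟩
      · rw [hfm]; exact ⟨huu.1, huu.2.1, huu.2.2, by simp⟩
      · rw [hf x (by lia)]
        obtain ⟨a, b, c, d⟩ := h2 x hx2
        exact ⟨a, b, c, fun h => d (Finset.mem_of_mem_erase h)⟩
    · intro x y hx hy hxy
      rcases hM x hx with rfl | ⟨hx1, hx2⟩ <;> rcases hM y hy with rfl | ⟨hy1, hy2⟩
      · rfl
      · rw [hfm, hf y (by lia)] at hxy
        exact absurd hxy.symm (key y hy2)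
      · rw [hfm, hf x (by lia)] at hxy
        exact absurd hxy (key x hx2)
      · rw [hf x (by lia), hf y (by lia)] at hxy
        exact h3 x y hx2 hy2 hxy
    · intro z hz hzn hzN
      have hzm : z ≠ m := fun h => hDm.not_isUndotted (h ▸ hzN)
      rcases h4 z (by lia) hzn hzN with hzU | ⟨y, hy, rfl⟩
      · by_cases hzu : z = u
        · exact Or.inr ⟨m, ⟨by lia, hm, hDm, by rw [hfm]; lia⟩, by rw [hfm, hzu]⟩
        · exact Or.inl (Finset.mem_erase.2 ⟨hzu, hzU⟩)
      · exact Or.inr ⟨y, (hM' y hy).1, hf y (hM' y hy).2⟩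
    · intro x hx y hxy hyx hy
      rcases hM x hx with rfl | ⟨hx1, hx2⟩
      · rw [hfm] at hyx ⊢
        rw [hf y (by lia)]
        have hne : f y ≠ y := fun h => by
          have := h7 y hxy (by lia) hy h u hu
          lia
        refine ⟨hne, ?_⟩
        have hyM : IsMatched S n x f y := ⟨hxy, by lia, hy, hne⟩
        by_contra hlt
        have := key y hyM
        obtain ⟨y', -, hy', e⟩ := h6 y hyM u hyx (by lia) huu.2.2
        exact key y' hy' e
      · rw [hf x (by lia)] at hyx ⊢
        rw [hf y (by lia)]
        exact h5 x hx2 y hxy hyx hy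
    · intro x hx z hxz hzx hz
      rcases hM x hx with rfl | ⟨hx1, hx2⟩
      · rw [hfm] at hzx
        rcases h4 z hxz (by lia) hz with hzU | ⟨y, hy, rfl⟩
        · have := hmin z hzU
          lia
        · exact ⟨y, hy.1, (hM' y hy).1, hf y (hM' y hy).2⟩
      · rw [hf x (by lia)] at hzx
        obtain ⟨y, hy1, hy, e⟩ := h6 x hx2 z hxz hzx hz
        exact ⟨y, hy1, (hM' y hy).1, (hf y (hM' y hy).2).trans e⟩
    · intro y hy hyn hyD hfy v hv
      by_cases hym : y = m
      · subst hym
        rw [hfm] at hfy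
        lia
      · rw [hf y hym] at hfy
        exact h7 y (by lia) hyn hyD hfy v (Finset.mem_of_mem_erase hv)
  · rw [Finset.not_nonempty_iff_eq_empty] at hU
    subst hU
    simp only
    have hDm : IsDotted S m := hD
    have hf : ∀ x, x ≠ m → Function.update f m m x = f x := fun x hx => by simp [hx]
    have hM : ∀ x, IsMatched S n (m - 1) (Function.update f m m) x →
        x ≠ m ∧ IsMatched S n m f x := by
      rintro x ⟨a, b, c, d⟩
      by_cases hx : x = m
      · simp [hx] at d
      · rw [hf x hx] at d
        exact ⟨hx, by lia, b, c, d⟩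
    have hM' : ∀ x, IsMatched S n m f x →
        IsMatched S n (m - 1) (Function.update f m m) x ∧ x ≠ m := by
      rintro x ⟨a, b, c, d⟩
      have : x ≠ m := by lia
      exact ⟨⟨by lia, b, c, by rwa [hf x this]⟩, this⟩
    refine ⟨by simp, ?_, ?_, ?_, ?_, ?_, by simp⟩
    · intro x hx
      obtain ⟨hxm, hx⟩ := hM x hx
      rw [hf x hxm]
      exact h2 x hx
    · intro x y hx hy hxy
      obtain ⟨hxm, hx⟩ := hM x hx
      obtain ⟨hym, hy⟩ := hM y hy
      rw [hf x hxm, hf y hym] at hxy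
      exact h3 x y hx hy hxy
    · intro z hz hzn hzN
      have hzm : z ≠ m := fun h => hDm.not_isUndotted (h ▸ hzN)
      rcases h4 z (by lia) hzn hzN with hzU | ⟨y, hy, rfl⟩
      · exact Or.inl hzU
      · exact Or.inr ⟨y, (hM' y hy).1, hf y (hM' y hy).2⟩
    · intro x hx y hxy hyx hy
      obtain ⟨hxm, hx⟩ := hM x hx
      have := hx.1
      rw [hf x hxm] at hyx ⊢
      rw [hf y (by lia)]
      exact h5 x hx y hxy hyx hy
    · intro x hx z hxz hzx hz
      obtain ⟨hxm, hx⟩ := hM x hx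
      rw [hf x hxm] at hzx
      obtain ⟨y, hy1, hy, e⟩ := h6 x hx z hxz hzx hz
      exact ⟨y, hy1, (hM' y hy).1, (hf y (hM' y hy).2).trans e⟩
  · have hNm : IsUndotted S m := hN
    have hM : ∀ x, IsMatched S n (m - 1) f x ↔ IsMatched S n m f x := by
      intro x
      refine ⟨fun ⟨a, b, c, d⟩ => ⟨?_, b, c, d⟩, fun ⟨a, b, c, d⟩ => ⟨by lia, b, c, d⟩⟩
      have : x ≠ m := fun h => c.not_isUndotted (h ▸ hNm)
      lia
    simp only
    refine ⟨?_, ?_, ?_, ?_, ?_, ?_, ?_⟩ <;> try simp only [hM]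
    · intro u hu
      rcases Finset.mem_insert.1 hu with rfl | hu
      · exact ⟨by lia, hm, hNm⟩
      · obtain ⟨a, b, c⟩ := h1 u hu
        exact ⟨by lia, b, c⟩
    · intro x hx
      obtain ⟨a, b, c, d⟩ := h2 x hx
      have := hx.1
      refine ⟨a, b, c, fun h => ?_⟩
      rcases Finset.mem_insert.1 h with h | h
      · lia
      · exact d h
    · exact h3
    · intro z hz hzn hzN
      by_cases hzm : z = m
      · exact Or.inl (Finset.mem_insert.2 (Or.inl hzm))
      · exact (h4 z (by lia) hzn hzN).imp_left Finset.mem_insert_of_mem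
    · exact h5
    · exact h6
    · intro y hy hyn hyD hfy u hu
      have : y ≠ m := fun h => hyD.not_isUndotted (h ▸ hNm)
      rcases Finset.mem_insert.1 hu with rfl | hu
      · lia
      · exact h7 y (by lia) hyn hyD hfy u hu
  · have hM : ∀ x, IsMatched S n (m - 1) f x ↔ IsMatched S n m f x := by
      intro x
      refine ⟨fun ⟨a, b, c, d⟩ => ⟨?_, b, c, d⟩, fun ⟨a, b, c, d⟩ => ⟨by lia, b, c, d⟩⟩
      have : x ≠ m := fun h => hD (h ▸ c)
      lia
    simp only
    refine ⟨?_, ?_, ?_, ?_, ?_, ?_, ?_⟩ <;> try simp only [hM]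
    · intro u hu
      obtain ⟨a, b, c⟩ := h1 u hu
      exact ⟨by lia, b, c⟩
    · exact h2
    · exact h3
    · intro z hz hzn hzN
      have : z ≠ m := fun h => hN (h ▸ hzN)
      exact h4 z (by lia) hzn hzN
    · exact h5
    · exact h6
    · intro y hy hyn hyD hfy
      have : y ≠ m := fun h => hD (h ▸ hyD)
      exact h7 y (by lia) hyn hyD hfy

lemma matchInvariant_foldl (n : ℤ) (S : Finset ℤ) (k : ℕ) :
    let p := ((List.range k).map (fun t : ℕ => n - t)).foldl
      (fun p x => stepCol S x p) ((id, ∅) : (ℤ → ℤ) × Finset ℤ)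
    MatchInvariant S n (n - k) p.1 p.2 := by
  induction k with
  | zero =>
    have hM : ∀ x, ¬ IsMatched S n (n - (0 : ℕ)) id x := fun x hx => hx.2.2.2 rfl
    refine ⟨by simp, fun x hx => absurd hx (hM x), fun x _ hx => absurd hx (hM x), ?_,
      fun x hx => absurd hx (hM x), fun x hx => absurd hx (hM x), by simp⟩
    intro z hz hzn
    simp only [Nat.cast_zero] at hz
    lia
  | succ k ih =>
    rw [List.range_succ, List.map_append, List.foldl_append]
    have := ih.step (by lia)
    rw [show n - ((k + 1 : ℕ) : ℤ) = n - k - 1 by push_cast; ring]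
    exact this

lemma matchInvariant_matchData (n : ℕ) (S : Finset ℤ) :
    MatchInvariant S n 0 (matchCol n S) (matchData n S).2 := by
  have h := matchInvariant_foldl n S n
  rw [sub_self] at h
  change MatchInvariant S n 0 (matchData n S).1 (matchData n S).2
  simpa [matchData, ← List.map_eq_flatMap, Function.comp_def] using h

/-- The contribution of column `z` to the exponent `w_{<i}(T)`: it is `1` if `z` is undotted,
`-1` if `z` is fully dotted and `0` otherwise. -/
def colWeight (T : Finset ℤ) (z : ℤ) : ℤ :=
  1 - (if z ∈ T then 1 else 0) - (if -z ∈ T then 1 else 0)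

lemma card_eq_two_mul_card_filter_pos {A : Finset ℤ} (hA : ∀ x ∈ A, -x ∈ A) (h0 : 0 ∉ A) :
    A.card = 2 * (A.filter (fun x => 0 < x)).card := by
  have hneg : (A.filter (fun x => ¬ 0 < x)).card = (A.filter (fun x => 0 < x)).card := by
    refine Finset.card_nbij' (fun x => -x) (fun x => -x) ?_ ?_
      (fun x _ => neg_neg x) (fun x _ => neg_neg x)
    · intro x hx
      simp only [Finset.coe_filter, Set.mem_ofPred_eq] at hx ⊢
      have : x ≠ 0 := fun h => h0 (h ▸ hx.1)
      exact ⟨hA x hx.1, by lia⟩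
    · intro x hx
      simp only [Finset.coe_filter, Set.mem_ofPred_eq] at hx ⊢
      exact ⟨hA x hx.1, by lia⟩
  have := Finset.card_filter_add_card_filter_not (s := A) (fun x => 0 < x)
  lia

lemma mem_negSet {A : Finset ℤ} {z : ℤ} : z ∈ negSet A ↔ -z ∈ A := by
  simp only [negSet, Finset.mem_image]
  exact ⟨fun ⟨a, ha, e⟩ => by rwa [← e, neg_neg], fun h => ⟨-z, h, neg_neg z⟩⟩

lemma mem_pmSet {A : Finset ℤ} {z : ℤ} : z ∈ pmSet A ↔ z ∈ A ∨ -z ∈ A := by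
  simp [pmSet, mem_negSet]

lemma mem_Szero {S : Finset ℤ} {z : ℤ} : z ∈ Szero S ↔ z ∈ S ∧ -z ∈ S := by
  simp [Szero, mem_negSet]

lemma mem_Iset {n : ℕ} {z : ℤ} : z ∈ Iset n ↔ z ≠ 0 ∧ -(n : ℤ) ≤ z ∧ z ≤ n := by
  simp [Iset]

lemma mem_Szeroc {n : ℕ} {S : Finset ℤ} {z : ℤ} :
    z ∈ Szeroc n S ↔ z ∈ Iset n ∧ z ∉ S ∧ -z ∉ S := by
  simp only [Szeroc, Finset.mem_inter, mem_negSet, Finset.mem_sdiff, mem_Iset]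
  constructor
  · tauto
  · rintro ⟨h, h1, h2⟩
    exact ⟨⟨h, h1⟩, ⟨by lia, h2⟩⟩

lemma wLt_eq_sum_colWeight {n : ℕ} {i : ℤ} (hi : i ≤ n) (T : Finset ℤ) :
    wLt n i T = ∑ z ∈ Finset.Ico 1 i, colWeight T z := by
  have hU := card_eq_two_mul_card_filter_pos
    (A := (Szeroc n T).filter (fun x => x ≠ 0 ∧ |x| < i)) (by
      intro x
      simp only [Finset.mem_filter, mem_Szeroc, mem_Iset, neg_neg, abs_neg]
      rintro ⟨⟨h, h1, h2⟩, h3, h4⟩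
      exact ⟨⟨by lia, h2, h1⟩, by lia, h4⟩) (by simp)
  have hD := card_eq_two_mul_card_filter_pos
    (A := (Szero T).filter (fun x => x ≠ 0 ∧ |x| < i)) (by
      intro x
      simp only [Finset.mem_filter, mem_Szero, neg_neg, abs_neg]
      rintro ⟨⟨h1, h2⟩, h3, h4⟩
      exact ⟨⟨h2, h1⟩, by lia, h4⟩) (by simp)
  have eU : ((Szeroc n T).filter (fun x => x ≠ 0 ∧ |x| < i)).filter (fun x => 0 < x) =
      (Finset.Ico 1 i).filter (fun z => z ∉ T ∧ -z ∉ T) := by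
    ext x
    simp only [Finset.mem_filter, mem_Szeroc, mem_Iset, Finset.mem_Ico, abs_lt]
    constructor
    · rintro ⟨⟨⟨-, h⟩, -, h2⟩, h3⟩
      exact ⟨by lia, h⟩
    · rintro ⟨h1, h⟩
      exact ⟨⟨⟨by lia, h⟩, by lia, by lia⟩, by lia⟩
  have eD : ((Szero T).filter (fun x => x ≠ 0 ∧ |x| < i)).filter (fun x => 0 < x) =
      (Finset.Ico 1 i).filter (fun z => z ∈ T ∧ -z ∈ T) := by
    ext x
    simp only [Finset.mem_filter, mem_Szero, Finset.mem_Ico, abs_lt]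
    constructor
    · rintro ⟨⟨h, -, h2⟩, h3⟩
      exact ⟨by lia, h⟩
    · rintro ⟨h1, h⟩
      exact ⟨⟨h, by lia, by lia⟩, by lia⟩
  rw [wLt, hU, hD, eU, eD]
  have : ∑ z ∈ Finset.Ico 1 i, colWeight T z =
      (((Finset.Ico 1 i).filter (fun z => z ∉ T ∧ -z ∉ T)).card : ℤ) -
        ((Finset.Ico 1 i).filter (fun z => z ∈ T ∧ -z ∈ T)).card := by
    rw [Finset.card_filter, Finset.card_filter]
    push_cast
    rw [← Finset.sum_sub_distrib]
    refine Finset.sum_congr rfl fun z _ => ?_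
    unfold colWeight
    by_cases h1 : z ∈ T <;> by_cases h2 : -z ∈ T <;> simp [h1, h2]
  rw [this]
  push_cast
  lia

/-- The index of the summand of `b_S` attached to `X`. -/
def movedSet (n : ℕ) (S X : Finset ℤ) : Finset ℤ :=
  (S \ pmSet X) ∪ pmSet (X.image (matchCol n S))

/-- Every fully dotted column of `S` is matched to an undotted column. -/
def AllMatched (n : ℕ) (S : Finset ℤ) : Prop :=
  ∀ x ∈ Finset.Icc (1 : ℤ) (n : ℤ), x ∈ S → -x ∈ S → matchCol n S x ≠ x

section

variable {n : ℕ} {S X : Finset ℤ}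

lemma mem_LSet {x : ℤ} : x ∈ LSet n S ↔ IsMatched S n 0 (matchCol n S) x := by
  simp only [LSet, IsMatched, IsDotted, Finset.mem_filter, Finset.mem_Icc]
  grind

lemma AllMatched.mem_LSet (h : AllMatched n S) {x : ℤ} (h0 : 0 < x) (hn : x ≤ n)
    (hx : IsDotted S x) : x ∈ LSet n S :=
  _root_.mem_LSet.2 ⟨h0, hn, hx, h x (Finset.mem_Icc.2 ⟨h0, hn⟩) hx.1 hx.2⟩

lemma isDotted_of_mem_LSet {x : ℤ} (hx : x ∈ LSet n S) : IsDotted S x := (mem_LSet.1 hx).2.2.1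

lemma pos_of_mem_LSet {x : ℤ} (hx : x ∈ LSet n S) : 0 < x := (mem_LSet.1 hx).1

lemma lt_matchCol {x : ℤ} (hx : x ∈ LSet n S) : x < matchCol n S x :=
  ((matchInvariant_matchData n S).target x (mem_LSet.1 hx)).1

lemma matchCol_le {x : ℤ} (hx : x ∈ LSet n S) : matchCol n S x ≤ n :=
  ((matchInvariant_matchData n S).target x (mem_LSet.1 hx)).2.1

lemma isUndotted_matchCol {x : ℤ} (hx : x ∈ LSet n S) : IsUndotted S (matchCol n S x) :=
  ((matchInvariant_matchData n S).target x (mem_LSet.1 hx)).2.2.1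

lemma matchCol_injOn : Set.InjOn (matchCol n S) (LSet n S) := fun x hx y hy =>
  (matchInvariant_matchData n S).inj x y (mem_LSet.1 hx) (mem_LSet.1 hy)

lemma matchCol_ne {x y : ℤ} (hx : x ∈ LSet n S) (hy : y ∈ LSet n S) : matchCol n S x ≠ y :=
  fun h => (isDotted_of_mem_LSet hy).not_isUndotted (h ▸ isUndotted_matchCol hx)

lemma matchCol_mem_image (hX : X ⊆ LSet n S) {x : ℤ} (hx : x ∈ LSet n S) :
    matchCol n S x ∈ X.image (matchCol n S) ↔ x ∈ X := by
  rw [Finset.mem_image]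
  exact ⟨fun ⟨y, hy, e⟩ => matchCol_injOn (hX hy) hx e ▸ hy, fun h => ⟨x, h, rfl⟩⟩

lemma notMem_image_of_mem_LSet (hX : X ⊆ LSet n S) {x : ℤ} (hx : x ∈ LSet n S) :
    x ∉ X.image (matchCol n S) := by
  rw [Finset.mem_image]
  rintro ⟨y, hy, e⟩
  exact matchCol_ne (hX hy) hx e

lemma pos_of_mem_image (hX : X ⊆ LSet n S) {z : ℤ} (hz : z ∈ X.image (matchCol n S)) : 0 < z := by
  obtain ⟨y, hy, rfl⟩ := Finset.mem_image.1 hz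
  exact (pos_of_mem_LSet (hX hy)).trans (lt_matchCol (hX hy))

lemma mem_movedSet (hX : X ⊆ LSet n S) {z : ℤ} (hz : 0 < z) :
    z ∈ movedSet n S X ↔ (z ∈ S ∧ z ∉ X) ∨ z ∈ X.image (matchCol n S) := by
  have h1 : -z ∉ X := fun h => by have := pos_of_mem_LSet (hX h); lia
  have h2 : -z ∉ X.image (matchCol n S) := fun h => by have := pos_of_mem_image hX h; lia
  simp only [movedSet, Finset.mem_union, Finset.mem_sdiff, mem_pmSet, h1, h2, or_false]

lemma neg_mem_movedSet (hX : X ⊆ LSet n S) {z : ℤ} (hz : 0 < z) :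
    -z ∈ movedSet n S X ↔ (-z ∈ S ∧ z ∉ X) ∨ z ∈ X.image (matchCol n S) := by
  have h1 : -z ∉ X := fun h => by have := pos_of_mem_LSet (hX h); lia
  have h2 : -z ∉ X.image (matchCol n S) := fun h => by have := pos_of_mem_image hX h; lia
  simp only [movedSet, Finset.mem_union, Finset.mem_sdiff, mem_pmSet, h1, h2, false_or, neg_neg]

lemma movedSet_subset_Iset (hS : S ⊆ Iset n) (hX : X ⊆ LSet n S) : movedSet n S X ⊆ Iset n := by
  intro z hz
  simp only [movedSet, Finset.mem_union, Finset.mem_sdiff, mem_pmSet, Finset.mem_image] at hz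
  rcases hz with hz | ⟨y, hy, e⟩ | ⟨y, hy, e⟩
  · exact hS hz.1
  all_goals
    have := pos_of_mem_LSet (hX hy)
    have := lt_matchCol (hX hy)
    have := matchCol_le (hX hy)
    rw [mem_Iset]
    lia

lemma colWeight_movedSet_self (hX : X ⊆ LSet n S) {x : ℤ} (hx : x ∈ LSet n S) :
    colWeight (movedSet n S X) x = if x ∈ X then 1 else -1 := by
  have h := isDotted_of_mem_LSet hx
  have := notMem_image_of_mem_LSet hX hx
  have h0 := pos_of_mem_LSet hx
  simp only [colWeight, mem_movedSet hX h0, neg_mem_movedSet hX h0, h.1, h.2, this]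
  by_cases hxX : x ∈ X <;> simp [hxX]

lemma colWeight_movedSet_matchCol (hX : X ⊆ LSet n S) {x : ℤ} (hx : x ∈ LSet n S) :
    colWeight (movedSet n S X) (matchCol n S x) = if x ∈ X then -1 else 1 := by
  have h := isUndotted_matchCol hx
  have h0 := (pos_of_mem_LSet hx).trans (lt_matchCol hx)
  simp only [colWeight, mem_movedSet hX h0, neg_mem_movedSet hX h0, h.1, h.2,
    matchCol_mem_image hX hx]
  by_cases hxX : x ∈ X <;> simp [hxX]

lemma colWeight_movedSet_of_half (hX : X ⊆ LSet n S) {z : ℤ} (h0 : 0 < z)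
    (hD : ¬ IsDotted S z) (hU : ¬ IsUndotted S z) : colWeight (movedSet n S X) z = 0 := by
  have h1 : z ∉ X := fun h => hD (isDotted_of_mem_LSet (hX h))
  have h2 : z ∉ X.image (matchCol n S) := by
    rw [Finset.mem_image]
    rintro ⟨y, hy, rfl⟩
    exact hU (isUndotted_matchCol (hX hy))
  simp only [colWeight, mem_movedSet hX h0, neg_mem_movedSet hX h0, h1, h2]
  unfold IsDotted at hD
  unfold IsUndotted at hU
  by_cases a : z ∈ S <;> by_cases b : -z ∈ S <;> simp_all

lemma sum_colWeight_between (h : AllMatched n S) (hX : X ⊆ LSet n S) {x : ℤ}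
    (hx : x ∈ LSet n S) :
    ∑ z ∈ Finset.Ioo x (matchCol n S x), colWeight (movedSet n S X) z = 0 := by
  have inv := matchInvariant_matchData n S
  have hxM := mem_LSet.1 hx
  have hx0 := pos_of_mem_LSet hx
  have hxn := matchCol_le hx
  set D := (LSet n S).filter (fun y => y ∈ Finset.Ioo x (matchCol n S x))
  have hDL : D ⊆ LSet n S := Finset.filter_subset _ _
  have hdisj : Disjoint D (D.image (matchCol n S)) := by
    rw [Finset.disjoint_left]
    exact fun y hy => notMem_image_of_mem_LSet hDL (hDL hy)
  have hsub : D ∪ D.image (matchCol n S) ⊆ Finset.Ioo x (matchCol n S x) := by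
    refine Finset.union_subset (fun y hy => (Finset.mem_filter.1 hy).2) ?_
    intro z hz
    obtain ⟨y, hy, rfl⟩ := Finset.mem_image.1 hz
    obtain ⟨hyL, hyI⟩ := Finset.mem_filter.1 hy
    rw [Finset.mem_Ioo] at hyI ⊢
    exact ⟨hyI.1.trans (lt_matchCol hyL),
      (inv.inner_dotted x hxM y hyI.1 hyI.2 (isDotted_of_mem_LSet hyL)).2⟩
  rw [← Finset.sum_subset hsub, Finset.sum_union hdisj,
    Finset.sum_image (matchCol_injOn.mono (by exact_mod_cast hDL)), ← Finset.sum_add_distrib]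
  · refine Finset.sum_eq_zero fun y hy => ?_
    rw [colWeight_movedSet_self hX (hDL hy), colWeight_movedSet_matchCol hX (hDL hy)]
    split_ifs <;> simp
  · intro z hz hzn
    have hz' := Finset.mem_Ioo.1 hz
    rw [Finset.mem_union, not_or] at hzn
    refine colWeight_movedSet_of_half hX (hx0.trans hz'.1) (fun hd => hzn.1 ?_)
      fun hu => hzn.2 ?_
    · exact Finset.mem_filter.2 ⟨h.mem_LSet (hx0.trans hz'.1) (by lia) hd, hz⟩
    · obtain ⟨y, hy1, hy, rfl⟩ := inv.inner_undotted x hxM z hz'.1 hz'.2 hu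
      refine Finset.mem_image_of_mem _ (Finset.mem_filter.2 ⟨mem_LSet.2 hy, ?_⟩)
      have := lt_matchCol (mem_LSet.2 hy)
      rw [Finset.mem_Ioo]
      lia

lemma colWeight_movedSet_insert {x z : ℤ} (hX : X ⊆ LSet n S) (hx : x ∈ LSet n S) (h0 : 0 < z)
    (hzx : z < x) :
    colWeight (movedSet n S (insert x X)) z = colWeight (movedSet n S X) z := by
  have hX' : insert x X ⊆ LSet n S := Finset.insert_subset hx hX
  have h1 : z ≠ matchCol n S x := (hzx.trans (lt_matchCol hx)).ne
  simp only [colWeight, mem_movedSet hX h0, neg_mem_movedSet hX h0, mem_movedSet hX' h0,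
    neg_mem_movedSet hX' h0, Finset.image_insert, Finset.mem_insert, hzx.ne, h1, false_or]

lemma wLt_movedSet_insert (h : AllMatched n S) {x : ℤ} (hX : X ⊆ LSet n S) (hx : x ∈ LSet n S) :
    wLt n (matchCol n S x) (movedSet n S (insert x X)) = wLt n x (movedSet n S X) + 1 := by
  have hX' : insert x X ⊆ LSet n S := Finset.insert_subset hx hX
  have hlt := lt_matchCol hx
  have h0 := pos_of_mem_LSet hx
  rw [wLt_eq_sum_colWeight (matchCol_le hx), wLt_eq_sum_colWeight (hlt.le.trans (matchCol_le hx)),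
    ← Finset.Ico_union_Ico_eq_Ico (show 1 ≤ x from h0) hlt.le,
    Finset.sum_union (Finset.Ico_disjoint_Ico_consecutive 1 x _),
    ← Finset.Ioo_insert_left hlt, Finset.sum_insert Finset.left_notMem_Ioo,
    sum_colWeight_between h hX' hx, colWeight_movedSet_self hX' hx]
  simp only [Finset.mem_insert_self, if_true, add_zero]
  congr 1
  refine Finset.sum_congr rfl fun z hz => ?_
  rw [Finset.mem_Ico] at hz
  exact colWeight_movedSet_insert hX hx (by lia) hz.2

lemma movedSet_insert_erase {x : ℤ} (hX : X ⊆ LSet n S) (hx : x ∈ LSet n S) (hxX : x ∉ X) :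
    ((movedSet n S (insert x X)).erase (matchCol n S x)).erase (-matchCol n S x) =
      ((movedSet n S X).erase x).erase (-x) := by
  have hU := isUndotted_matchCol hx
  have h0 := pos_of_mem_LSet hx
  have hlt := lt_matchCol hx
  have h1 := notMem_image_of_mem_LSet hX hx
  have h2 := mt (matchCol_mem_image hX hx).1 hxX
  ext z
  simp only [movedSet, Finset.mem_erase, Finset.mem_union, Finset.mem_sdiff, mem_pmSet,
    Finset.image_insert, Finset.mem_insert]
  unfold IsUndotted at hU
  have hY : ∀ z ∈ X.image (matchCol n S), 0 < z := fun z => pos_of_mem_image hX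
  generalize X.image (matchCol n S) = Y at *
  generalize matchCol n S x = y at *
  grind

lemma filter_dotted_movedSet (h : AllMatched n S) (hX : X ⊆ LSet n S) :
    (Finset.Icc (1 : ℤ) n).filter
        (fun i => i ∈ Szero (movedSet n S X) ∧ -i ∈ Szero (movedSet n S X)) =
      (LSet n S).image (fun x => if x ∈ X then matchCol n S x else x) := by
  ext z
  simp only [Finset.mem_filter, mem_Szero, neg_neg, Finset.mem_image, Finset.mem_Icc]
  constructor
  · rintro ⟨⟨hz, hzn⟩, ⟨h1, h2⟩, -⟩
    rw [mem_movedSet hX (by lia)] at h1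
    rw [neg_mem_movedSet hX (by lia)] at h2
    by_cases hz' : z ∈ X.image (matchCol n S)
    · obtain ⟨y, hy, rfl⟩ := Finset.mem_image.1 hz'
      exact ⟨y, hX hy, by simp [hy]⟩
    · simp only [hz', or_false] at h1 h2
      exact ⟨z, h.mem_LSet (by lia) hzn ⟨h1.1, h2.1⟩, by simp [h1.2]⟩
  · rintro ⟨x, hx, rfl⟩
    have h0 := pos_of_mem_LSet hx
    have hlt := lt_matchCol hx
    have hle := matchCol_le hx
    have hd := isDotted_of_mem_LSet hx
    split_ifs with hxX
    · have := (matchCol_mem_image hX hx).2 hxX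
      rw [mem_movedSet hX (h0.trans hlt), neg_mem_movedSet hX (h0.trans hlt)]
      exact ⟨by lia, ⟨Or.inr this, Or.inr this⟩, Or.inr this, Or.inr this⟩
    · rw [mem_movedSet hX h0, neg_mem_movedSet hX h0]
      exact ⟨by lia, ⟨Or.inl ⟨hd.1, hxX⟩, Or.inl ⟨hd.2, hxX⟩⟩, Or.inl ⟨hd.2, hxX⟩,
        Or.inl ⟨hd.1, hxX⟩⟩

lemma FAct_movedSet (h : AllMatched n S) (hX : X ⊆ LSet n S) :
    FAct n (movedSet n S X) = ∑ x ∈ LSet n S,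
      let i := if x ∈ X then matchCol n S x else x
      ((-qv) ^ wLt n i (movedSet n S X)) • vS n (((movedSet n S X).erase i).erase (-i)) := by
  rw [FAct, filter_dotted_movedSet h hX, Finset.sum_image]
  intro x hx y hy e
  simp only at e
  split_ifs at e
  · exact matchCol_injOn hx hy e
  · exact absurd e (matchCol_ne hx hy)
  · exact absurd e.symm (matchCol_ne hy hx)
  · exact e

end

lemma Fop_vS {n : ℕ} {T : Finset ℤ} (hT : T ⊆ Iset n) : Fop n (vS n T) = FAct n T := by
  simp [Fop, mkOp, vS, hT]

/-- if every fully dotted column of S is matched to an undotted column,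
then F·b_S = 0. -/
theorem stmt7 (n : ℕ) (hn : 1 ≤ n) (S : Bset n)
    (h : ∀ x ∈ Finset.Icc (1 : ℤ) (n : ℤ), x ∈ S.1 → -x ∈ S.1 → matchCol n S.1 x ≠ x) :
    Fop n (bvecL n S.1) = 0 := by
  obtain ⟨S, hS⟩ := S
  replace h : AllMatched n S := h
  simp only
  have hexp : Fop n (bvecL n S) = ∑ x ∈ LSet n S, ∑ X ∈ (LSet n S).powerset,
      (qv ^ (-(X.card : ℤ))) •
        (let i := if x ∈ X then matchCol n S x else x
        ((-qv) ^ wLt n i (movedSet n S X)) •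
          vS n (((movedSet n S X).erase i).erase (-i))) := by
    rw [Finset.sum_comm, bvecL, map_sum]
    refine Finset.sum_congr rfl fun X hX => ?_
    have hX := Finset.mem_powerset.1 hX
    rw [map_smul, ← Finset.smul_sum, ← FAct_movedSet h hX,
      ← Fop_vS (movedSet_subset_Iset hS hX), movedSet]
  rw [hexp]
  refine Finset.sum_eq_zero fun x hx => ?_
  have hq : qv ≠ 0 := RatFunc.X_ne_zero
  conv_lhs => rw [← Finset.insert_erase hx]
  rw [Finset.sum_powerset_insert (Finset.notMem_erase x _), ← Finset.sum_add_distrib]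
  refine Finset.sum_eq_zero fun X hX => ?_
  have hXe := Finset.mem_powerset.1 hX
  have hxX : x ∉ X := fun hx' => Finset.notMem_erase x _ (hXe hx')
  have hXL : X ⊆ LSet n S := hXe.trans (Finset.erase_subset _ _)
  simp only [hxX, if_false, Finset.mem_insert_self, if_true]
  rw [movedSet_insert_erase hXL hx hxX, wLt_movedSet_insert h hXL hx,
    Finset.card_insert_of_notMem hxX, smul_smul, smul_smul, ← add_smul,
    zpow_add₀ (neg_ne_zero.2 hq), Nat.cast_add, neg_add, zpow_add₀ hq]
  refine smul_eq_zero_of_left ?_ _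
  simp only [Nat.cast_one, zpow_neg_one, zpow_one]
  field_simp
  ring

end
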